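/- Product construction for failure of weak unique continuation in two variables: Fix 0 < p < 2. Suppose w ∈ C_c^∞(ℂ) is supported in the closed unit disk, and W : ℂ → [0,∞) is measurable with W ∈ L^p(ℂ) and |∂̄w(z)| ≤ W(z)|w(z)| for all z ∈ ℂ. Define u : ℂ² → ℂ by u(z₁,z₂) = w(z₁)w(z₂) and V(z₁,z₂) = W(z₁)·χ_{D₁}(z₂) + W(z₂)·χ_{D₁}(z₁), where χ_{D₁} is the characteristic function of the unit disk D₁. Then u is smooth with compact support contained in D̄₁ × D̄₁, u satisfies |∂̄u(z₁,z₂)| ≤ V(z₁,z₂)|u(z₁,z₂)| for all (z₁,z₂) ∈ ℂ², where |∂̄u| = (|∂̄₁u|² + |∂̄₂u|²)^{1/2}, and V ∈ L^p(ℂ²), i.e. ∫_{ℂ²} V^p dv < ∞. -/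

import Mathlib

open MeasureTheory Metric

/-- The first (pointwise) `∂̄`-operator on `ℂ²`:
`∂̄₁u(z) = (∂_{x_1} u(z) + i ∂_{y_1} u(z))/2`, from the real Fréchet derivative. -/
noncomputable def dbar1 (u : ℂ × ℂ → ℂ) (z : ℂ × ℂ) : ℂ :=
  (fderiv ℝ u z (1, 0) + Complex.I * fderiv ℝ u z (Complex.I, 0)) / 2

/-- The second (pointwise) `∂̄`-operator on `ℂ²`:
`∂̄₂u(z) = (∂_{x_2} u(z) + i ∂_{y_2} u(z))/2`, from the real Fréchet derivative. -/
noncomputable def dbar2 (u : ℂ × ℂ → ℂ) (z : ℂ × ℂ) : ℂ :=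
  (fderiv ℝ u z (0, 1) + Complex.I * fderiv ℝ u z (0, Complex.I)) / 2

/-- A function whose topological support lies in a closed ball of nonzero radius vanishes off the
open ball. -/
theorem mem_ball_of_tsupport_subset_closedBall {w : ℂ → ℂ} (hw : Continuous w) {c : ℂ} {r : ℝ}
    (hr : r ≠ 0) (h : tsupport w ⊆ closedBall c r) {z : ℂ} (hz : w z ≠ 0) : z ∈ ball c r := by
  rw [← interior_closedBall c hr]
  exact interior_maximal ((subset_tsupport w).trans h) hw.isOpen_support hz

theorem fderiv_fst_mul_snd_apply {w : ℂ → ℂ} (hw : Differentiable ℝ w) (z v : ℂ × ℂ) :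
    fderiv ℝ (fun z : ℂ × ℂ => w z.1 * w z.2) z v =
      w z.1 * fderiv ℝ w z.2 v.2 + w z.2 * fderiv ℝ w z.1 v.1 := by
  have h1 : HasFDerivAt (fun z : ℂ × ℂ => w z.1)
      ((fderiv ℝ w z.1).comp (ContinuousLinearMap.fst ℝ ℂ ℂ)) z :=
    (hw z.1).hasFDerivAt.comp z hasFDerivAt_fst
  have h2 : HasFDerivAt (fun z : ℂ × ℂ => w z.2)
      ((fderiv ℝ w z.2).comp (ContinuousLinearMap.snd ℝ ℂ ℂ)) z :=
    (hw z.2).hasFDerivAt.comp z hasFDerivAt_snd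
  have h : HasFDerivAt (fun z : ℂ × ℂ => w z.1 * w z.2) _ z := h1.mul h2
  simp [h.fderiv]

theorem dbar1_fst_mul_snd {w : ℂ → ℂ} (hw : Differentiable ℝ w) (z : ℂ × ℂ) :
    dbar1 (fun z : ℂ × ℂ => w z.1 * w z.2) z =
      (fderiv ℝ w z.1 1 + Complex.I * fderiv ℝ w z.1 Complex.I) / 2 * w z.2 := by
  simp only [dbar1, fderiv_fst_mul_snd_apply hw, map_zero]
  ring

theorem dbar2_fst_mul_snd {w : ℂ → ℂ} (hw : Differentiable ℝ w) (z : ℂ × ℂ) :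
    dbar2 (fun z : ℂ × ℂ => w z.1 * w z.2) z =
      (fderiv ℝ w z.2 1 + Complex.I * fderiv ℝ w z.2 Complex.I) / 2 * w z.1 := by
  simp only [dbar2, fderiv_fst_mul_snd_apply hw, map_zero]
  ring

theorem Real.add_rpow_le_two_rpow_mul {a b p : ℝ} (ha : 0 ≤ a) (hb : 0 ≤ b) (hp : 0 ≤ p) :
    (a + b) ^ p ≤ 2 ^ p * (a ^ p + b ^ p) := by
  have hap := Real.rpow_nonneg ha p
  have hbp := Real.rpow_nonneg hb p
  rcases le_total a b with h | h
  · calc (a + b) ^ p ≤ (2 * b) ^ p := by gcongr; linarith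
      _ = 2 ^ p * b ^ p := Real.mul_rpow zero_le_two hb
      _ ≤ _ := by gcongr; linarith
  · calc (a + b) ^ p ≤ (2 * a) ^ p := by gcongr; linarith
      _ = 2 ^ p * a ^ p := Real.mul_rpow zero_le_two ha
      _ ≤ _ := by gcongr; linarith

theorem ofReal_mul_indicator_one_rpow {p : ℝ} (hp : 0 < p) (a : ℝ) (s : Set ℂ) (z : ℂ) :
    ENNReal.ofReal ((a * s.indicator (fun _ => (1 : ℝ)) z) ^ p) =
      ENNReal.ofReal (a ^ p) * s.indicator 1 z := by
  by_cases hz : z ∈ s <;> simp [hz, Real.zero_rpow hp.ne']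

/-- If `W ∈ L^p(ℂ)` and `s` has finite measure, then `W(z₁)χ_s(z₂) + W(z₂)χ_s(z₁)` is in
`L^p(ℂ²)`. -/
theorem lintegral_symm_mul_indicator_rpow_lt_top {p : ℝ} (hp : 0 < p) {W : ℂ → ℝ}
    (hW : Measurable W) (hW0 : ∀ z, 0 ≤ W z)
    (hWLp : (∫⁻ z : ℂ, ENNReal.ofReal (W z ^ p)) < ⊤) {s : Set ℂ} (hs : MeasurableSet s)
    (hs' : volume s < ⊤) :
    (∫⁻ z : ℂ × ℂ, ENNReal.ofReal ((W z.1 * s.indicator (fun _ => (1 : ℝ)) z.2 +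
      W z.2 * s.indicator (fun _ => (1 : ℝ)) z.1) ^ p)) < ⊤ := by
  have hf : Measurable fun z => ENNReal.ofReal (W z ^ p) := (hW.pow_const p).ennreal_ofReal
  have hg : Measurable (s.indicator (1 : ℂ → ENNReal)) := measurable_one.indicator hs
  have hχ (z : ℂ) : 0 ≤ s.indicator (fun _ => (1 : ℝ)) z :=
    Set.indicator_nonneg (fun _ _ => zero_le_one) z
  have hint : (∫⁻ z, s.indicator (1 : ℂ → ENNReal) z) < ⊤ := by
    rwa [lintegral_indicator_one hs]
  have hbound (z : ℂ × ℂ) :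
      ENNReal.ofReal ((W z.1 * s.indicator (fun _ => (1 : ℝ)) z.2 +
        W z.2 * s.indicator (fun _ => (1 : ℝ)) z.1) ^ p) ≤
      ENNReal.ofReal (2 ^ p) * (ENNReal.ofReal (W z.1 ^ p) * s.indicator 1 z.2 +
        s.indicator 1 z.1 * ENNReal.ofReal (W z.2 ^ p)) := by
    have ha := mul_nonneg (hW0 z.1) (hχ z.2)
    have hb := mul_nonneg (hW0 z.2) (hχ z.1)
    rw [mul_comm (s.indicator 1 z.1), ← ofReal_mul_indicator_one_rpow hp,
      ← ofReal_mul_indicator_one_rpow hp,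
      ← ENNReal.ofReal_add (Real.rpow_nonneg ha p) (Real.rpow_nonneg hb p),
      ← ENNReal.ofReal_mul (by positivity)]
    exact ENNReal.ofReal_le_ofReal (Real.add_rpow_le_two_rpow_mul ha hb hp.le)
  refine (lintegral_mono hbound).trans_lt ?_
  rw [lintegral_const_mul' _ _ ENNReal.ofReal_ne_top,
    lintegral_add_left (by fun_prop),
    Measure.volume_eq_prod, lintegral_prod_mul hf.aemeasurable hg.aemeasurable,
    lintegral_prod_mul hg.aemeasurable hf.aemeasurable]
  exact ENNReal.mul_lt_top ENNReal.ofReal_lt_top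
    (ENNReal.add_lt_top.2 ⟨ENNReal.mul_lt_top hWLp hint, ENNReal.mul_lt_top hint hWLp⟩)

/-- **Product construction for failure of weak unique continuation in two variables.**
Fix `0 < p < 2`.  If `w ∈ C_c^∞(ℂ)` is supported in the closed unit disk and
`W ∈ L^p(ℂ)` is nonnegative with `|∂̄w| ≤ W|w|` on `ℂ`, then `u(z₁,z₂) = w(z₁)w(z₂)` is
smooth with compact support in `D̄₁ × D̄₁`, satisfies `|∂̄u| ≤ V|u|` on `ℂ²` where
`V(z₁,z₂) = W(z₁)χ_{D₁}(z₂) + W(z₂)χ_{D₁}(z₁)`, and `V ∈ L^p(ℂ²)`. -/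
theorem product_construction_failure_wucp (p : ℝ) (hp0 : 0 < p) (hp2 : p < 2)
    (w : ℂ → ℂ) (hw : ContDiff ℝ (⊤ : ℕ∞) w) (hwsupp : HasCompactSupport w)
    (hwball : tsupport w ⊆ closedBall (0 : ℂ) 1)
    (W : ℂ → ℝ) (hWmeas : Measurable W) (hWpos : ∀ z, 0 ≤ W z)
    (hWLp : (∫⁻ z : ℂ, ENNReal.ofReal (W z ^ p)) < ⊤)
    (hWineq : ∀ z : ℂ,
      ‖(fderiv ℝ w z 1 + Complex.I * fderiv ℝ w z Complex.I) / 2‖ ≤ W z * ‖w z‖) :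
    ContDiff ℝ (⊤ : ℕ∞) (fun z : ℂ × ℂ => w z.1 * w z.2) ∧
    HasCompactSupport (fun z : ℂ × ℂ => w z.1 * w z.2) ∧
    tsupport (fun z : ℂ × ℂ => w z.1 * w z.2) ⊆
      closedBall (0 : ℂ) 1 ×ˢ closedBall (0 : ℂ) 1 ∧
    (∀ z : ℂ × ℂ,
      Real.sqrt (‖dbar1 (fun z : ℂ × ℂ => w z.1 * w z.2) z‖ ^ 2 +
          ‖dbar2 (fun z : ℂ × ℂ => w z.1 * w z.2) z‖ ^ 2)
        ≤ (W z.1 * (ball (0 : ℂ) 1).indicator (fun _ => (1 : ℝ)) z.2 +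
            W z.2 * (ball (0 : ℂ) 1).indicator (fun _ => (1 : ℝ)) z.1) * ‖w z.1 * w z.2‖) ∧
    (∫⁻ z : ℂ × ℂ,
        ENNReal.ofReal ((W z.1 * (ball (0 : ℂ) 1).indicator (fun _ => (1 : ℝ)) z.2 +
          W z.2 * (ball (0 : ℂ) 1).indicator (fun _ => (1 : ℝ)) z.1) ^ p)) < ⊤ := by
  have hdiff : Differentiable ℝ w := hw.differentiable (by simp)
  have hsupp : tsupport (fun z : ℂ × ℂ => w z.1 * w z.2) ⊆
      closedBall (0 : ℂ) 1 ×ˢ closedBall (0 : ℂ) 1 :=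
    closure_minimal (fun z hz => ⟨hwball (subset_tsupport w (left_ne_zero_of_mul hz)),
      hwball (subset_tsupport w (right_ne_zero_of_mul hz))⟩)
      (isClosed_closedBall.prod isClosed_closedBall)
  have hbound (a b : ℂ) :
      ‖(fderiv ℝ w a 1 + Complex.I * fderiv ℝ w a Complex.I) / 2 * w b‖ ≤
        W a * (ball (0 : ℂ) 1).indicator (fun _ => (1 : ℝ)) b * (‖w a‖ * ‖w b‖) := by
    rw [norm_mul]
    by_cases hb : w b = 0
    · simp [hb]
    · rw [Set.indicator_of_mem
        (mem_ball_of_tsupport_subset_closedBall hw.continuous one_ne_zero hwball hb), mul_one,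
        ← mul_assoc]
      exact mul_le_mul_of_nonneg_right (hWineq a) (norm_nonneg _)
  refine ⟨(hw.comp contDiff_fst).mul (hw.comp contDiff_snd),
    ((isCompact_closedBall _ _).prod (isCompact_closedBall _ _)).of_isClosed_subset
      (isClosed_tsupport _) hsupp, hsupp, fun z => ?_,
    lintegral_symm_mul_indicator_rpow_lt_top hp0 hWmeas hWpos hWLp measurableSet_ball
      measure_ball_lt_top⟩
  rw [dbar1_fst_mul_snd hdiff, dbar2_fst_mul_snd hdiff, norm_mul (w z.1), add_mul]
  have h1 := hbound z.1 z.2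
  have h2 := hbound z.2 z.1
  rw [mul_comm ‖w z.2‖] at h2
  refine le_trans ?_ (add_le_add h1 h2)
  exact Real.sqrt_le_iff.2 ⟨by positivity, by
    nlinarith [mul_nonneg (norm_nonneg ((fderiv ℝ w z.1 1 +
      Complex.I * fderiv ℝ w z.1 Complex.I) / 2 * w z.2)) (norm_nonneg ((fderiv ℝ w z.2 1 +
      Complex.I * fderiv ℝ w z.2 Complex.I) / 2 * w z.1))]⟩
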